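/- arXiv:2407.17921 — 4 statements merged into one kernel-verified Lean document; each statement's English description precedes it below -/
import Mathlib

section
/- For every vertex v ∈ V, the function M_v is an element of the graph equivariant cohomology H*(GQ_{2n−1}); that is, for every pair of distinct vertices i, j ∈ V, the polynomial α(ij) divides M_v(i) − M_v(j) in R. -/
open MvPolynomial Finset

noncomputable section

abbrev Rr (n : ℕ) := MvPolynomial (Fin n) ℤ

/-- The "opposite" vertex: 0-indexed version of i ↦ 2n+1−i. -/
def bar {n : ℕ} (i : Fin (2*n)) : Fin (2*n) :=
  ⟨2*n - 1 - i.val, by have := i.isLt; omega⟩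

/-- The weight α_i (0-indexed): α_i = X i for i < n, and α_i = −α_{bar i} otherwise. -/
def av {n : ℕ} (i : Fin (2*n)) : Rr n :=
  if h : i.val < n then X ⟨i.val, h⟩
  else - X ⟨2*n - 1 - i.val, by have := i.isLt; omega⟩

/-- The axial function α(ij). -/
def ax {n : ℕ} (i j : Fin (2*n)) : Rr n :=
  if j = bar i then - av i else - av i + av j

/-- The class M_v. -/
def Mv {n : ℕ} (v : Fin (2*n)) : Fin (2*n) → Rr n := fun j =>
  if j = v then 0 else if j = bar v then 2 * av v else - av j + av v

/-- The class Q. -/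
def Qf {n : ℕ} : Fin (2*n) → Rr n := fun j => - av j

/-- Independence: K contains no pair {i, bar i}. -/
def indep {n : ℕ} (K : Finset (Fin (2*n))) : Prop :=
  ∀ i : Fin (2*n), ¬ ({i, bar i} : Finset (Fin (2*n))) ⊆ K

/-- The class Δ_K. -/
def Del {n : ℕ} (K : Finset (Fin (2*n))) : Fin (2*n) → Rr n := fun j =>
  if j ∈ K then ∏ k ∈ Kᶜ, ax j k else 0

/-- The class Δ'_K. -/
def Del' {n : ℕ} (K : Finset (Fin (2*n))) : Fin (2*n) → Rr n := fun j =>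
  if j ∈ K then ∏ k ∈ (K ∪ {bar j})ᶜ, ax j k else 0

/-- The graph equivariant cohomology H*(GQ_{2n−1}) as a subring of the ring of
functions V → R with pointwise operations. -/
def HGQ (n : ℕ) : Subring (Fin (2*n) → Rr n) where
  carrier := {f | ∀ i j : Fin (2*n), i ≠ j → ax i j ∣ f i - f j}
  zero_mem' := fun i j _ => by simp
  one_mem' := fun i j _ => by simp
  add_mem' := by
    intro a b ha hb i j h
    have e : (a + b) i - (a + b) j = (a i - a j) + (b i - b j) := by
      simp only [Pi.add_apply]; ring
    rw [e]; exact dvd_add (ha i j h) (hb i j h)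
  neg_mem' := by
    intro a ha i j h
    have e : (-a) i - (-a) j = -(a i - a j) := by
      simp only [Pi.neg_apply]; ring
    rw [e]; exact dvd_neg.mpr (ha i j h)
  mul_mem' := by
    intro a b ha hb i j h
    have e : (a * b) i - (a * b) j = a i * (b i - b j) + (a i - a j) * b j := by
      simp only [Pi.mul_apply]; ring
    rw [e]; exact dvd_add ((hb i j h).mul_left _) ((ha i j h).mul_right _)

/-- The graph equivariant cohomology H*(GQ_{2n−2}) (edges i j with j ≠ bar i only). -/
def HGQe (n : ℕ) : Subring (Fin (2*n) → Rr n) where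
  carrier := {f | ∀ i j : Fin (2*n), i ≠ j → j ≠ bar i → ax i j ∣ f i - f j}
  zero_mem' := fun i j _ _ => by simp
  one_mem' := fun i j _ _ => by simp
  add_mem' := by
    intro a b ha hb i j h h'
    have e : (a + b) i - (a + b) j = (a i - a j) + (b i - b j) := by
      simp only [Pi.add_apply]; ring
    rw [e]; exact dvd_add (ha i j h h') (hb i j h h')
  neg_mem' := by
    intro a ha i j h h'
    have e : (-a) i - (-a) j = -(a i - a j) := by
      simp only [Pi.neg_apply]; ring
    rw [e]; exact dvd_neg.mpr (ha i j h h')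
  mul_mem' := by
    intro a b ha hb i j h h'
    have e : (a * b) i - (a * b) j = a i * (b i - b j) + (a i - a j) * b j := by
      simp only [Pi.mul_apply]; ring
    rw [e]; exact dvd_add ((hb i j h h').mul_left _) ((ha i j h h').mul_right _)


theorem av_bar {n : ℕ} (i : Fin (2*n)) : av (bar i) = - av i := by
  have hi := i.isLt
  by_cases h : i.val < n
  · have h' : ¬ (bar i).val < n := by simp only [bar]; omega
    rw [av, av, dif_neg h', dif_pos h]
    congr 3
    simp only [bar]
    omega
  · have h' : (bar i).val < n := by simp only [bar]; omega
    rw [av, av, dif_pos h', dif_neg h, neg_neg]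
    rfl

/-- The three cases in the definition of `Mv` are given by a single formula. -/
theorem Mv_apply {n : ℕ} (v j : Fin (2*n)) : Mv v j = - av j + av v := by
  unfold Mv
  split_ifs with h h'
  · rw [h, neg_add_cancel]
  · rw [h', av_bar]
    ring
  · rfl

/-- For every vertex v, M_v ∈ H*(GQ_{2n−1}): for all distinct i, j,
α(ij) divides M_v(i) − M_v(j). -/
theorem stmt0 (n : ℕ) (hn : 1 ≤ n) (v : Fin (2*n)) :
    Mv v ∈ HGQ n := by
  intro i j _
  rw [Mv_apply, Mv_apply]
  unfold ax
  split_ifs with h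
  · rw [h, av_bar]
    exact ⟨2, by ring⟩
  · exact ⟨1, by ring⟩

end
end

section
/- If K ⊆ V is an independent subset with |K| = n, then 2Δ_K = ∏_{i ∈ V∖K} M_i as functions V → R (pointwise product). -/
open MvPolynomial Finset

noncomputable section

theorem bar_bar {n : ℕ} (i : Fin (2*n)) : bar (bar i) = i := by
  apply Fin.ext
  have := i.isLt
  simp only [bar]
  omega

theorem Mv_self {n : ℕ} (v : Fin (2*n)) : Mv v v = 0 := if_pos rfl

theorem Mv_bar_of_ne {n : ℕ} {j : Fin (2*n)} (h : j ≠ bar j) :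
    Mv (bar j) j = 2 * ax j (bar j) := by
  rw [Mv, if_neg h, bar_bar, if_pos rfl, ax, if_pos rfl, av_bar]

theorem Mv_of_ne {n : ℕ} {v j : Fin (2*n)} (h : j ≠ v) (h' : v ≠ bar j) :
    Mv v j = ax j v := by
  have h'' : j ≠ bar v := fun e => h' (by rw [e, bar_bar])
  rw [Mv, if_neg h, if_neg h'', ax, if_neg h']

theorem indep.bar_notMem {n : ℕ} {K : Finset (Fin (2*n))} (hK : indep K)
    {j : Fin (2*n)} (hj : j ∈ K) : bar j ∉ K := fun h =>
  hK j (by simp [Finset.insert_subset_iff, hj, h])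

/-- Relation 3: if K is independent with |K| = n, then
2Δ_K = ∏_{i ∈ V∖K} M_i pointwise. -/
theorem stmt7 (n : ℕ) (hn : 1 ≤ n) (K : Finset (Fin (2*n)))
    (hK : indep K) (hc : K.card = n) :
    2 * Del K = ∏ i ∈ Kᶜ, Mv i := by
  funext j
  rw [Finset.prod_apply, Pi.mul_apply, Pi.ofNat_apply, Del]
  by_cases hj : j ∈ K
  · have hb : bar j ∈ Kᶜ := Finset.mem_compl.mpr (hK.bar_notMem hj)
    rw [if_pos hj, ← Finset.mul_prod_erase _ _ hb, ← Finset.mul_prod_erase _ _ hb,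
      Mv_bar_of_ne fun e => hK.bar_notMem hj (e ▸ hj), mul_assoc]
    congr 2
    refine Finset.prod_congr rfl fun k hk => ?_
    obtain ⟨hkb, hkK⟩ := Finset.mem_erase.mp hk
    exact (Mv_of_ne (fun e : j = k => Finset.mem_compl.mp hkK (e ▸ hj)) hkb).symm
  · rw [if_neg hj, mul_zero]
    exact (Finset.prod_eq_zero (f := fun c => Mv c j) (Finset.mem_compl.mpr hj) (Mv_self j)).symm

end
end

section
/- The 2n functions 1, M_1, M_1M_2, …, M_1⋯M_{n−1}, Δ_{{n+1,…,2n}}, Δ_{{n+2,…,2n}}, …, Δ_{{2n}} form a basis of H*(GQ_{2n−1}) as a module over R (with R acting by constant functions); in particular, if h_1 + h_2·M_1 + ⋯ + h_n·M_1⋯M_{n−1} + h_{n+1}·Δ_{{n+1,…,2n}} + ⋯ + h_{2n}·Δ_{{2n}} = 0 with h_1,…,h_{2n} ∈ R, then h_1 = ⋯ = h_{2n} = 0. -/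
open MvPolynomial Finset

noncomputable section

/-- The 2n functions 1, M_1, M_1M_2, …, M_1⋯M_{n−1}, Δ_{{n+1,…,2n}}, …, Δ_{{2n}}
(0-indexed by k : Fin (2n)). -/
def basisFun {n : ℕ} (k : Fin (2*n)) : Fin (2*n) → Rr n :=
  if k.val < n then ∏ j ∈ univ.filter (fun j : Fin (2*n) => j.val < k.val), Mv j
  else Del (univ.filter (fun j : Fin (2*n) => k.val ≤ j.val))

theorem bar_ne {n : ℕ} (i : Fin (2*n)) : bar i ≠ i := by
  intro h; have := congrArg Fin.val h; have := i.isLt; simp only [bar] at *; omega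

theorem ax_bar {n : ℕ} (i : Fin (2*n)) : ax i (bar i) = - av i := if_pos rfl

theorem ax_of_ne_bar {n : ℕ} {i j : Fin (2*n)} (h : j ≠ bar i) : ax i j = - av i + av j :=
  if_neg h

/-- The index of the variable occurring in the weight of a vertex. -/
def weightIndex {n : ℕ} (i : Fin (2*n)) : Fin n :=
  if h : i.val < n then ⟨i.val, h⟩ else ⟨2*n - 1 - i.val, by have := i.isLt; omega⟩

theorem av_eq_ite {n : ℕ} (i : Fin (2*n)) :
    av i = if i.val < n then X (weightIndex i) else - X (weightIndex i) := by
  unfold av weightIndex; split_ifs <;> rfl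

theorem weightIndex_ne {n : ℕ} {i k : Fin (2*n)} (h : i ≠ k) (h' : i ≠ bar k) :
    weightIndex i ≠ weightIndex k := by
  intro e
  have hi := i.isLt
  have hk := k.isLt
  have e := congrArg Fin.val e
  have h : i.val ≠ k.val := fun q => h (Fin.ext q)
  have h' : i.val ≠ 2*n - 1 - k.val := fun q => h' (Fin.ext q)
  unfold weightIndex at e
  split_ifs at e <;> simp only at e <;> omega

/-- Integer values of the weights that are nonzero and pairwise distinct. -/
def genericValue {n : ℕ} (i : Fin (2*n)) : ℤ :=
  if i.val < n then (i.val : ℤ) + 1 else (i.val : ℤ) - 2*n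

theorem genericValue_ne_zero {n : ℕ} (i : Fin (2*n)) : genericValue i ≠ 0 := by
  have := i.isLt; unfold genericValue; split_ifs <;> omega

theorem genericValue_injective {n : ℕ} :
    Function.Injective (genericValue : Fin (2*n) → ℤ) := by
  intro i j h
  have := i.isLt
  have := j.isLt
  apply Fin.ext
  unfold genericValue at h
  split_ifs at h <;> omega

theorem exists_specialization {n : ℕ} (k : Fin (2*n)) (c : ℤ) :
    ∃ φ : Rr n →+* ℤ, φ (av k) = c ∧
      ∀ i, i ≠ k → i ≠ bar k → φ (av i) = genericValue i := by
  refine ⟨eval fun t => if t = weightIndex k then (if k.val < n then c else -c)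
    else (t.val : ℤ) + 1, ?_, fun i h h' => ?_⟩
  · rw [av_eq_ite]; split_ifs <;> simp_all
  · have := i.isLt
    have e := weightIndex_ne h h'
    rw [av_eq_ite]
    by_cases hi : i.val < n
    · simp [hi, e, genericValue]; simp [weightIndex, hi]
    · simp [hi, e, genericValue]; simp [weightIndex, hi]; omega

theorem not_ax_dvd_ax {n : ℕ} {k i j : Fin (2*n)} (hi : i ≠ k) (hj : j ≠ k) (hij : i ≠ j) :
    ¬ ax k i ∣ ax k j := by
  intro hd
  by_cases hib : i = bar k
  · obtain ⟨φ, hk, hφ⟩ := exists_specialization k 0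
    have hjb : j ≠ bar k := fun h => hij (hib.trans h.symm)
    have hd := map_dvd φ hd
    simp only [ax, if_pos hib, if_neg hjb, map_add, map_neg, hk, hφ j hj hjb,
      neg_zero, zero_add, zero_dvd_iff] at hd
    exact genericValue_ne_zero j hd
  · obtain ⟨φ, hk, hφ⟩ := exists_specialization k (genericValue i)
    have hd := map_dvd φ hd
    simp only [ax, if_neg hib, map_add, map_neg, hk, hφ i hi hib, neg_add_cancel,
      zero_dvd_iff] at hd
    split_ifs at hd with hjb
    · rw [map_neg, hk, neg_eq_zero] at hd
      exact genericValue_ne_zero i hd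
    · rw [map_add, map_neg, hk, hφ j hj hjb] at hd
      exact hij (genericValue_injective (by linarith))

theorem totalDegree_av_le {n : ℕ} (i : Fin (2*n)) : (av i).totalDegree ≤ 1 := by
  rw [av_eq_ite]; split_ifs
  · exact (totalDegree_X _).le
  · rw [totalDegree_neg]; exact (totalDegree_X _).le

theorem irreducible_ax {n : ℕ} {k i : Fin (2*n)} (hi : i ≠ k) : Irreducible (ax k i) := by
  have hc : IsUnit (coeff (Finsupp.single (weightIndex k) 1) (ax k i)) := by
    have hk : IsUnit (coeff (Finsupp.single (weightIndex k) 1) (- av k)) := by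
      rw [av_eq_ite]; split_ifs <;> simp
    unfold ax
    split_ifs with hib
    · exact hk
    · have : coeff (Finsupp.single (weightIndex k) 1) (av i) = 0 := by
        rw [av_eq_ite]
        split_ifs <;> simp [coeff_X, Finsupp.single_left_inj, weightIndex_ne hi hib]
      rwa [coeff_add, this, add_zero]
  apply irreducible_of_totalDegree_eq_one
  · apply le_antisymm
    · unfold ax
      split_ifs
      · rw [totalDegree_neg]; exact totalDegree_av_le k
      · refine (totalDegree_add _ _).trans (max_le ?_ (totalDegree_av_le i))
        rw [totalDegree_neg]; exact totalDegree_av_le k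
    · simpa using le_totalDegree (mem_support_iff.mpr hc.ne_zero)
  · exact fun x hx => isUnit_of_dvd_unit (hx _) hc

theorem ax_dvd_av_sub {n : ℕ} (i j : Fin (2*n)) : ax i j ∣ av i - av j := by
  unfold ax
  split_ifs with h
  · rw [h, av_bar]; exact ⟨-2, by ring⟩
  · exact ⟨-1, by ring⟩

theorem ax_comm_dvd {n : ℕ} (i j : Fin (2*n)) : ax i j ∣ ax j i := by
  by_cases h : j = bar i
  · subst h
    simp [ax, bar_bar, av_bar]
  · have h' : i ≠ bar j := fun e => h (by rw [e, bar_bar])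
    rw [ax, ax, if_neg h, if_neg h']
    exact ⟨-1, by ring⟩

theorem Mv_mem_HGQ {n : ℕ} (v : Fin (2*n)) : Mv v ∈ HGQ n := by
  intro i j _
  rw [Mv_apply, Mv_apply, show - av i + av v - (- av j + av v) = -(av i - av j) by ring]
  exact (ax_dvd_av_sub i j).neg_right

theorem const_mem_HGQ {n : ℕ} (r : Rr n) : Function.const (Fin (2*n)) r ∈ HGQ n := by
  intro i j _
  simp

theorem ax_dvd_prod_sub_prod {n : ℕ} {K : Finset (Fin (2*n))} (hK : indep K)
    {i j : Fin (2*n)} (hi : i ∈ K) (hj : j ∈ K) :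
    ax i j ∣ ∏ k ∈ Kᶜ, ax i k - ∏ k ∈ Kᶜ, ax j k := by
  have hbar : ∀ a ∈ K, bar a ∉ K := fun a ha hb => hK a (by
    intro x hx
    rcases mem_insert.mp hx with rfl | hx
    · exact ha
    · rwa [mem_singleton.mp hx])
  have hib := hbar i hi
  have hjb := hbar j hj
  have hav := ax_dvd_av_sub i j
  rw [← Ideal.mem_span_singleton, ← Ideal.Quotient.eq] at hav ⊢
  rw [map_prod, map_prod]
  refine prod_equiv (Equiv.swap (bar i) (bar j)) (fun k => ?_) (fun k hk => ?_)
  · by_cases h1 : k = bar i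
    · simp [h1, hib, hjb]
    by_cases h2 : k = bar j
    · simp [h2, hib, hjb]
    rw [Equiv.swap_apply_of_ne_of_ne h1 h2]
  · by_cases h1 : k = bar i
    · subst h1
      rw [Equiv.swap_apply_left, ax_bar, ax_bar, map_neg, map_neg, hav]
    by_cases h2 : k = bar j
    · subst h2
      have h1' : bar i ≠ bar j := fun h => h1 h.symm
      rw [Equiv.swap_apply_right, ax_of_ne_bar h1, ax_of_ne_bar h1', av_bar, av_bar]
      simp only [map_add, map_neg, hav]
    rw [Equiv.swap_apply_of_ne_of_ne h1 h2, ax_of_ne_bar h1, ax_of_ne_bar h2]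
    simp only [map_add, map_neg, hav]

theorem Del_mem_HGQ {n : ℕ} {K : Finset (Fin (2*n))} (hK : indep K) : Del K ∈ HGQ n := by
  intro i j _
  by_cases hi : i ∈ K <;> by_cases hj : j ∈ K <;> simp only [Del, hi, hj, if_true, if_false]
  · exact ax_dvd_prod_sub_prod hK hi hj
  · rw [sub_zero]
    exact dvd_prod_of_mem _ (mem_compl.mpr hj)
  · rw [zero_sub]
    exact ((ax_comm_dvd i j).trans (dvd_prod_of_mem (ax j) (mem_compl.mpr hi))).neg_right
  · simp

theorem basisFun_mem_HGQ {n : ℕ} (k : Fin (2*n)) : basisFun k ∈ HGQ n := by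
  unfold basisFun
  split_ifs with h
  · exact prod_mem fun j _ => Mv_mem_HGQ j
  · refine Del_mem_HGQ fun i hi => ?_
    have h1 : i ∈ univ.filter fun j : Fin (2*n) => k.val ≤ j.val := hi (by simp)
    have h2 : bar i ∈ univ.filter fun j : Fin (2*n) => k.val ≤ j.val := hi (by simp)
    simp only [mem_filter, mem_univ, true_and, bar] at h1 h2
    omega

theorem basisFun_apply_of_lt {n : ℕ} {k j : Fin (2*n)} (h : j < k) : basisFun k j = 0 := by
  unfold basisFun
  split_ifs with hk
  · rw [prod_apply]
    exact prod_eq_zero (i := j) (by simpa using h) (by simp [Mv])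
  · simp [Del, h]

theorem basisFun_apply_self {n : ℕ} (k : Fin (2*n)) :
    basisFun k k = ∏ j ∈ univ.filter (fun j : Fin (2*n) => j < k), ax k j := by
  unfold basisFun
  split_ifs with hk
  · rw [prod_apply]
    refine prod_congr rfl fun j hj => ?_
    have hj : j.val < k.val := by simpa using hj
    have hjb : j ≠ bar k := fun e => by
      have := congrArg Fin.val e
      simp only [bar] at this
      omega
    rw [Mv_apply, ax, if_neg hjb]
  · rw [Del, if_pos (by simp)]
    refine prod_congr ?_ fun _ _ => rfl
    ext j
    simp

theorem basisFun_apply_self_ne_zero {n : ℕ} (k : Fin (2*n)) : basisFun k k ≠ 0 := by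
  rw [basisFun_apply_self, prod_ne_zero_iff]
  exact fun j hj => (irreducible_ax (mem_filter.mp hj).2.ne).ne_zero

theorem basisFun_apply_self_dvd {n : ℕ} {f : Fin (2*n) → Rr n} (hf : f ∈ HGQ n)
    {k : Fin (2*n)} (hk : ∀ j < k, f j = 0) : basisFun k k ∣ f k := by
  rw [basisFun_apply_self]
  refine prod_dvd_of_isRelPrime (fun i hi j hj hij => ?_) fun j hj => ?_
  · have hi := (mem_filter.mp hi).2.ne
    have hj := (mem_filter.mp hj).2.ne
    exact (irreducible_ax hi).isRelPrime_iff_not_dvd.mpr (not_ax_dvd_ax hi hj hij)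
  · have hj := (mem_filter.mp hj).2
    have := hf k j hj.ne'
    rwa [hk j hj, sub_zero] at this

theorem exists_combination_eq_on_initial {n : ℕ} {f : Fin (2*n) → Rr n} (hf : f ∈ HGQ n) (m : ℕ)
    (hm : m ≤ 2*n) :
    ∃ h : Fin (2*n) → Rr n, ∀ j : Fin (2*n), j.val < m →
      f j = ∑ k, h k * basisFun k j := by
  induction m with
  | zero => exact ⟨0, fun j hj => absurd hj (Nat.not_lt_zero _)⟩
  | succ m ih =>
    obtain ⟨h, hh⟩ := ih (Nat.le_of_succ_le hm)
    let k₀ : Fin (2*n) := ⟨m, hm⟩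
    have hg : f - ∑ k, Function.const (Fin (2*n)) (h k) * basisFun k ∈ HGQ n :=
      sub_mem hf (sum_mem fun k _ => mul_mem (const_mem_HGQ _) (basisFun_mem_HGQ k))
    obtain ⟨c, hc⟩ := basisFun_apply_self_dvd hg (k := k₀) fun j hj => by
      simp [hh j hj]
    refine ⟨h + Pi.single k₀ c, fun j hj => ?_⟩
    have hs : ∑ k, (h + Pi.single k₀ c : Fin (2*n) → Rr n) k * basisFun k j
        = ∑ k, h k * basisFun k j + c * basisFun k₀ j := by
      simp [add_mul, sum_add_distrib, Pi.single_apply]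
    rw [hs]
    rcases Nat.lt_succ_iff_lt_or_eq.mp hj with hj | hj
    · rw [hh j hj, basisFun_apply_of_lt (show j < k₀ from hj), mul_zero, add_zero]
    · obtain rfl : j = k₀ := Fin.ext hj
      simp only [Pi.sub_apply, Finset.sum_apply, Pi.mul_apply, Function.const_apply] at hc
      rw [mul_comm c, ← hc]
      ring

/-- the 2n functions 1, M_1, M_1M_2, …, M_1⋯M_{n−1},
Δ_{{n+1,…,2n}}, …, Δ_{{2n}} form a basis of H*(GQ_{2n−1}) as an R-module: every element is
an R-linear combination of them, and if an R-linear combination vanishes then all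
coefficients vanish. -/
theorem stmt11 (n : ℕ) (hn : 1 ≤ n) :
    (∀ f : Fin (2*n) → Rr n, f ∈ HGQ n →
      ∃ h : Fin (2*n) → Rr n,
        f = ∑ k : Fin (2*n), Function.const (Fin (2*n)) (h k) * basisFun k) ∧
    (∀ h : Fin (2*n) → Rr n,
      ∑ k : Fin (2*n), Function.const (Fin (2*n)) (h k) * basisFun k = 0 →
      ∀ k, h k = 0) := by
  refine ⟨fun f hf => ?_, fun h hh k => ?_⟩
  · obtain ⟨h, hh⟩ := exists_combination_eq_on_initial hf (2*n) le_rfl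
    refine ⟨h, funext fun j => ?_⟩
    simpa using hh j j.isLt
  · induction k using WellFoundedLT.induction with
    | ind k ih =>
      have hk := congrFun hh k
      simp only [Finset.sum_apply, Pi.mul_apply, Function.const_apply, Pi.zero_apply] at hk
      rw [sum_eq_single k (fun j _ hj => ?_) (by simp)] at hk
      · exact (mul_eq_zero.mp hk).resolve_right (basisFun_apply_self_ne_zero k)
      · rcases lt_or_gt_of_ne hj with hj | hj
        · rw [ih j hj, zero_mul]
        · rw [basisFun_apply_of_lt hj, mul_zero]

end
end

section
/- The ring S = {(f,g) ∈ ℤ[a] × ℤ[a] : a divides f − g in ℤ[a]} (a subring of ℤ[a] × ℤ[a] with componentwise operations) is isomorphic to ℤ[x,y]/⟨xy⟩; an isomorphism is induced by x ↦ (−a, 0) and y ↦ (0, a). -/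
open MvPolynomial

noncomputable section

/-- The ring S = {(f,g) ∈ ℤ[a] × ℤ[a] : a ∣ f − g}, a subring of ℤ[a] × ℤ[a] with
componentwise operations. -/
def S1 : Subring (Polynomial ℤ × Polynomial ℤ) where
  carrier := {p | Polynomial.X ∣ p.1 - p.2}
  zero_mem' := by simp
  one_mem' := by simp
  add_mem' := by
    intro a b ha hb
    have e : (a + b).1 - (a + b).2 = (a.1 - a.2) + (b.1 - b.2) := by
      simp only [Prod.fst_add, Prod.snd_add]; ring
    show Polynomial.X ∣ (a + b).1 - (a + b).2
    rw [e]; exact dvd_add ha hb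
  neg_mem' := by
    intro a ha
    show Polynomial.X ∣ (-a).1 - (-a).2
    have e : (-a).1 - (-a).2 = -(a.1 - a.2) := by
      simp only [Prod.fst_neg, Prod.snd_neg]; ring
    rw [e]; exact dvd_neg.mpr ha
  mul_mem' := by
    intro a b ha hb
    show Polynomial.X ∣ (a * b).1 - (a * b).2
    have e : (a * b).1 - (a * b).2 = a.1 * (b.1 - b.2) + (a.1 - a.2) * b.2 := by
      simp only [Prod.fst_mul, Prod.snd_mul]; ring
    rw [e]; exact dvd_add (hb.mul_left _) (ha.mul_right _)

/-- The homomorphism ℤ[x,y] → ℤ[a] × ℤ[a] with x ↦ (−a, 0) and y ↦ (0, a). -/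
noncomputable def psi13 : MvPolynomial (Fin 2) ℤ →+* Polynomial ℤ × Polynomial ℤ :=
  (MvPolynomial.aeval
    ![((-Polynomial.X : Polynomial ℤ), (0 : Polynomial ℤ)),
      ((0 : Polynomial ℤ), (Polynomial.X : Polynomial ℤ))]).toRingHom

/-- The expected normal form modulo `xy`: a constant, a multiple of `x` in `ℤ[x]` and a multiple
of `y` in `ℤ[y]`. -/
def axisSum (c : ℤ) (f g : Polynomial ℤ) : MvPolynomial (Fin 2) ℤ :=
  C c + X 0 * Polynomial.aeval (X 0) f + X 1 * Polynomial.aeval (X 1) g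

theorem psi13_X_zero : psi13 (X 0) = (-Polynomial.X, 0) := by
  simp [psi13]

theorem psi13_X_one : psi13 (X 1) = (0, Polynomial.X) := by
  simp [psi13]

theorem psi13_C (c : ℤ) : psi13 (C c) = (Polynomial.C c, Polynomial.C c) := by
  ext1 <;> simp [psi13]

theorem psi13_aeval (q : MvPolynomial (Fin 2) ℤ) (f : Polynomial ℤ) :
    psi13 (Polynomial.aeval q f) = (f.comp (psi13 q).1, f.comp (psi13 q).2) := by
  induction f using Polynomial.induction_on' with
  | add p r hp hr => simp [hp, hr]
  | monomial n c => ext1 <;> simp [← Polynomial.C_mul_X_pow_eq_monomial]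

theorem psi13_axisSum (c : ℤ) (f g : Polynomial ℤ) :
    psi13 (axisSum c f g) =
      (Polynomial.C c - Polynomial.X * f.comp (-Polynomial.X),
        Polynomial.C c + Polynomial.X * g) := by
  simp only [axisSum, map_add, map_mul, psi13_C, psi13_aeval, psi13_X_zero, psi13_X_one]
  ext1 <;> simp [sub_eq_add_neg]

theorem exists_sub_axisSum_mem (p : MvPolynomial (Fin 2) ℤ) :
    ∃ c f g, p - axisSum c f g ∈
      Ideal.span {(X 0 : MvPolynomial (Fin 2) ℤ) * X 1} := by
  simp only [Ideal.mem_span_singleton']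
  induction p using MvPolynomial.induction_on with
  | C c => exact ⟨c, 0, 0, 0, by simp [axisSum]⟩
  | add p q hp hq =>
    obtain ⟨c, f, g, r, hr⟩ := hp
    obtain ⟨d, h, k, s, hs⟩ := hq
    refine ⟨c + d, f + h, g + k, r + s, ?_⟩
    simp only [axisSum, map_add] at *
    linear_combination hr + hs
  | mul_X p i hp =>
    obtain ⟨c, f, g, r, hr⟩ := hp
    fin_cases i
    · refine ⟨0, Polynomial.C c + Polynomial.X * f, 0,
        r * X 0 + Polynomial.aeval (X 1) g, ?_⟩
      simp only [axisSum, map_add, map_mul, map_zero, Polynomial.aeval_X, Polynomial.aeval_C,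
        algebraMap_eq, Fin.zero_eta] at *
      linear_combination X 0 * hr
    · refine ⟨0, 0, Polynomial.C c + Polynomial.X * g,
        r * X 1 + Polynomial.aeval (X 0) f, ?_⟩
      simp only [axisSum, map_add, map_mul, map_zero, Polynomial.aeval_X, Polynomial.aeval_C,
        algebraMap_eq, Fin.mk_one] at *
      linear_combination X 1 * hr

theorem psi13_X_mul_X : psi13 (X 0 * X 1) = 0 := by
  simp [psi13_X_zero, psi13_X_one]

theorem psi13_eq_zero_of_mem_span {p : MvPolynomial (Fin 2) ℤ}
    (hp : p ∈ Ideal.span {(X 0 : MvPolynomial (Fin 2) ℤ) * X 1}) : psi13 p = 0 := by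
  obtain ⟨r, rfl⟩ := Ideal.mem_span_singleton'.1 hp
  rw [map_mul, psi13_X_mul_X, mul_zero]

theorem axisSum_eq_zero_of_psi13_eq_zero {c : ℤ} {f g : Polynomial ℤ}
    (h : psi13 (axisSum c f g) = 0) : axisSum c f g = 0 := by
  rw [psi13_axisSum, Prod.mk_eq_zero] at h
  obtain ⟨h₁, h₂⟩ := h
  obtain rfl : c = 0 := by simpa using congrArg (Polynomial.eval 0) h₂
  obtain rfl : g = 0 := by simpa [Polynomial.X_ne_zero] using h₂
  have hf : f.comp (-Polynomial.X) = 0 := by simpa [Polynomial.X_ne_zero] using h₁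
  obtain rfl : f = 0 := by
    simpa [Polynomial.comp_assoc] using congrArg (fun q => q.comp (-Polynomial.X)) hf
  simp [axisSum]

theorem ker_psi13 :
    RingHom.ker psi13 = Ideal.span {(X 0 : MvPolynomial (Fin 2) ℤ) * X 1} := by
  ext p
  rw [RingHom.mem_ker]
  refine ⟨fun hp => ?_, psi13_eq_zero_of_mem_span⟩
  obtain ⟨c, f, g, h⟩ := exists_sub_axisSum_mem p
  have h₀ : psi13 (axisSum c f g) = 0 := by
    simpa [hp] using psi13_eq_zero_of_mem_span h
  simpa [axisSum_eq_zero_of_psi13_eq_zero h₀] using h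

theorem psi13_mem_S1 (p : MvPolynomial (Fin 2) ℤ) : psi13 p ∈ S1 := by
  obtain ⟨c, f, g, h⟩ := exists_sub_axisSum_mem p
  have hp : psi13 p = psi13 (axisSum c f g) := by
    simpa [sub_eq_zero] using psi13_eq_zero_of_mem_span h
  rw [hp, psi13_axisSum]
  exact ⟨-(f.comp (-Polynomial.X) + g), by ring⟩

theorem range_psi13 : psi13.range = S1 := by
  ext ⟨f, g⟩
  refine ⟨?_, fun h => ?_⟩
  · rintro ⟨p, hp⟩
    exact hp ▸ psi13_mem_S1 p
  · have h₀ : f.coeff 0 = g.coeff 0 := by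
      have h' : Polynomial.X ∣ f - g := h
      rwa [Polynomial.X_dvd_iff, Polynomial.coeff_sub, sub_eq_zero] at h'
    refine ⟨axisSum (g.coeff 0) (-f.divX.comp (-Polynomial.X)) g.divX, ?_⟩
    rw [psi13_axisSum]
    ext1
    · have := f.X_mul_divX_add
      rw [h₀] at this
      simpa [Polynomial.comp_assoc, add_comm] using this
    · simpa [add_comm] using g.X_mul_divX_add

/-- S ≅ ℤ[x,y]/⟨xy⟩, the isomorphism being induced by
x ↦ (−a, 0), y ↦ (0, a): this map has range S and kernel ⟨xy⟩. -/
theorem stmt13 :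
    Set.range psi13 = (S1 : Set (Polynomial ℤ × Polynomial ℤ)) ∧
    RingHom.ker psi13 = Ideal.span {(X 0 : MvPolynomial (Fin 2) ℤ) * X 1} ∧
    Nonempty ((MvPolynomial (Fin 2) ℤ ⧸
      Ideal.span {(X 0 : MvPolynomial (Fin 2) ℤ) * X 1}) ≃+* S1) := by
  refine ⟨?_, ker_psi13, ⟨?_⟩⟩
  · rw [← RingHom.coe_range, range_psi13]
  · exact (Ideal.quotEquivOfEq ker_psi13.symm).trans
      ((RingHom.quotientKerEquivRange psi13).trans (RingEquiv.subringCongr range_psi13))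

end
end
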